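/- Let n ≥ 3 and δ ∈ (0,(n−1)/(n+1)). Let μ ∈ Δ^n_+ satisfy μ_(1) = 1−δ, and let ν = Ř(μ) be the image of μ under the split-merge prerule. Then ν ∈ Δ^n_+ (in particular Σ_{i=1}^n ν_i = 1 and all ν_i > 0) and max_i ν_i ≤ 1−δ. -/

import Mathlib

open scoped BigOperators

/-- The open unit simplex `Δ⁺ₙ`. -/
def simplexPos (n : ℕ) : Set (Fin n → ℝ) := {μ | (∀ i, 0 < μ i) ∧ ∑ i, μ i = 1}

/-- The permutation `p` ranking the components of `μ` in decreasing order,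
ties broken in increasing order of index (stable sort of `-μ`). -/
noncomputable def rankPerm {n : ℕ} (μ : Fin n → ℝ) : Equiv.Perm (Fin n) :=
  Tuple.sort (fun i => -μ i)

/-- The `k`-th reverse order statistic `μ₍ₖ₊₁₎` (0-indexed): `ordStat μ 0` is the
largest component, `ordStat μ (n-1)` the smallest. -/
noncomputable def ordStat {n : ℕ} (μ : Fin n → ℝ) (k : Fin n) : ℝ :=
  μ (rankPerm μ k)

/-- The split-merge prerule `Ř` with diversity parameter `δ`: if `μ₍₁₎ ≥ 1-δ`, the largest
company (rank 1) is split in half, the new half being placed at the index of rank `n-1`,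
whose previous two smallest values (ranks `n-1`, `n`) merge into the index of rank `n`;
otherwise (and when `n < 3`) it is the identity. -/
noncomputable def preRule {n : ℕ} (δ : ℝ) (μ : Fin n → ℝ) : Fin n → ℝ :=
  if hn : 3 ≤ n then
    if ordStat μ ⟨0, by omega⟩ < 1 - δ then μ
    else fun i =>
      if ((rankPerm μ).symm i : ℕ) = 0 then ordStat μ ⟨0, by omega⟩ / 2
      else if ((rankPerm μ).symm i : ℕ) = n - 2 then ordStat μ ⟨0, by omega⟩ / 2
      else if ((rankPerm μ).symm i : ℕ) = n - 1 then
        ordStat μ ⟨n - 1, by omega⟩ + ordStat μ ⟨n - 2, by omega⟩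
      else μ i
  else μ

/-- The entropy function `S(x) = -∑ xᵢ log xᵢ`. -/
noncomputable def entS {n : ℕ} (x : Fin n → ℝ) : ℝ := -∑ i, x i * Real.log (x i)

theorem ordStat_antitone {n : ℕ} (μ : Fin n → ℝ) : Antitone (ordStat μ) := fun _ _ hij =>
  neg_le_neg_iff.mp (Tuple.monotone_sort (fun i => -μ i) hij)

theorem sum_ordStat {n : ℕ} (μ : Fin n → ℝ) : ∑ k, ordStat μ k = ∑ i, μ i :=
  Equiv.sum_comp (rankPerm μ) μ

/-- A sum over `Fin (m + 3)`, with the first and the last two terms split off. -/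
theorem Fin.sum_univ_first_last_two {m : ℕ} (f : Fin (m + 3) → ℝ) :
    ∑ k, f k = f 0 + (∑ i : Fin m, f i.castSucc.castSucc.succ
      + f (Fin.last m).castSucc.succ + f (Fin.last (m + 2))) := by
  rw [Fin.sum_univ_succ, Fin.sum_univ_castSucc, Fin.sum_univ_castSucc, Fin.succ_last]

/-- The values of the split-merge prerule, indexed by rank. -/
theorem preRule_rankPerm {m : ℕ} {δ : ℝ} {μ : Fin (m + 3) → ℝ}
    (htop : 1 - δ ≤ ordStat μ 0) (k : Fin (m + 3)) :
    preRule δ μ (rankPerm μ k) =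
      if (k : ℕ) = 0 then ordStat μ 0 / 2
      else if (k : ℕ) = m + 1 then ordStat μ 0 / 2
      else if (k : ℕ) = m + 2 then
        ordStat μ (Fin.last (m + 2)) + ordStat μ (Fin.last m).castSucc.succ
      else ordStat μ k := by
  have h3 : 3 ≤ m + 3 := by omega
  have hlt : ¬ ordStat μ ⟨0, by omega⟩ < 1 - δ := not_lt.mpr htop
  rw [preRule, dif_pos h3, if_neg hlt]
  simp only [Equiv.symm_apply_apply]
  rfl

/-- The two smallest components are together at most twice the average of all components
but the largest. -/
theorem add_two_mul_ordStat_last_two_le {m : ℕ} (μ : Fin (m + 3) → ℝ) :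
    ((m : ℝ) + 2) * (ordStat μ (Fin.last (m + 2)) + ordStat μ (Fin.last m).castSucc.succ)
      ≤ 2 * (∑ i, μ i - ordStat μ 0) := by
  have hsum := sum_ordStat μ
  rw [Fin.sum_univ_first_last_two] at hsum
  have hmid : (m : ℝ) * ordStat μ (Fin.last m).castSucc.succ
      ≤ ∑ i : Fin m, ordStat μ i.castSucc.castSucc.succ := by
    have h := Finset.card_nsmul_le_sum Finset.univ
      (fun i : Fin m => ordStat μ i.castSucc.castSucc.succ) (ordStat μ (Fin.last m).castSucc.succ)
      (fun i _ => ordStat_antitone μ (by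
        rw [Fin.le_def]
        simp only [Fin.val_succ, Fin.val_castSucc, Fin.val_last]
        omega))
    simpa using h
  have hlast : ordStat μ (Fin.last (m + 2)) ≤ ordStat μ (Fin.last m).castSucc.succ :=
    ordStat_antitone μ (Fin.le_last _)
  nlinarith [mul_le_mul_of_nonneg_left hlast (Nat.cast_nonneg (α := ℝ) m)]

theorem sum_preRule {m : ℕ} {δ : ℝ} {μ : Fin (m + 3) → ℝ} (htop : 1 - δ ≤ ordStat μ 0) :
    ∑ i, preRule δ μ i = ∑ i, μ i := by
  rw [← Equiv.sum_comp (rankPerm μ), ← sum_ordStat μ]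
  simp only [preRule_rankPerm htop]
  rw [Fin.sum_univ_first_last_two, Fin.sum_univ_first_last_two (ordStat μ)]
  have hmid : ∀ i : Fin m, (i : ℕ) ≠ m ∧ (i : ℕ) ≠ m + 1 := fun i => by omega
  simp [hmid]
  ring

/-- For `n ≥ 3` and `δ ∈ (0,(n-1)/(n+1))`, the split-merge prerule maps a
boundary point (`μ₍₁₎ = 1-δ`) of the open simplex back into the open simplex, with all
resulting weights at most `1-δ`. -/
theorem preRule_mem_closed_regulatory_set
    (n : ℕ) (hn : 3 ≤ n) (δ : ℝ)
    (hδ : δ ∈ Set.Ioo (0 : ℝ) (((n : ℝ) - 1) / ((n : ℝ) + 1)))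
    (μ : Fin n → ℝ) (hμ : μ ∈ simplexPos n)
    (htop : ordStat μ ⟨0, by omega⟩ = 1 - δ) :
    (∀ i, 0 < preRule δ μ i) ∧ (∑ i, preRule δ μ i = 1) ∧ (∀ i, preRule δ μ i ≤ 1 - δ) := by
  obtain ⟨m, rfl⟩ := Nat.exists_eq_add_of_le' hn
  obtain ⟨hpos, hsum⟩ := hμ
  obtain ⟨-, hδ⟩ := hδ
  change ordStat μ 0 = 1 - δ at htop
  have hord : ∀ k, 0 < ordStat μ k := fun k => hpos _
  have hmerge : ordStat μ (Fin.last (m + 2)) + ordStat μ (Fin.last m).castSucc.succ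
      ≤ 1 - δ := by
    have h := add_two_mul_ordStat_last_two_le μ
    rw [hsum, htop] at h
    have hm : (0 : ℝ) < m + 2 := by positivity
    push_cast at hδ
    rw [lt_div_iff₀ (by positivity)] at hδ
    nlinarith
  refine ⟨fun i => ?_, (sum_preRule htop.ge).trans hsum, fun i => ?_⟩ <;>
    obtain ⟨k, rfl⟩ := (rankPerm μ).surjective i <;>
    rw [preRule_rankPerm htop.ge]
  · have h0 := hord 0
    have hl := hord (Fin.last (m + 2))
    have hl' := hord (Fin.last m).castSucc.succ
    split_ifs <;> first | positivity | exact hord k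
  · have h0 := hord 0
    have hk := ordStat_antitone μ (Fin.zero_le k)
    split_ifs <;> linarith
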